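/- (Cantor-type intersection theorem) Let (X, d_φ, φ) be a φ-metric space. Then X is complete if and only if for every decreasing sequence F_1 ⊇ F_2 ⊇ F_3 ⊇ ⋯ of nonempty τ_φ-closed subsets of X with δ(F_i) → 0 as i → ∞, the intersection ⋂_{i=1}^∞ F_i contains exactly one point. -/

import Mathlib

open Filter Topology Set

/-- A φ-metric on a set `X`: a pair of functions `d : X × X → ℝ≥0` and
`phi : X × X × X → ℝ≥0` satisfying the axioms (d1)–(d3) and (φ1)–(φ3). -/
structure PhiMetric (X : Type*) where
  d : X → X → ℝ
  phi : X → X → X → ℝ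
  d_nonneg : ∀ x y, 0 ≤ d x y
  phi_nonneg : ∀ x y z, 0 ≤ phi x y z
  /-- (d1) -/
  d_eq_zero_iff : ∀ x y, d x y = 0 ↔ x = y
  /-- (d2) -/
  d_symm : ∀ x y, d x y = d y x
  /-- (d3) -/
  d_triangle : ∀ x y z, d x y ≤ d x z + d z y + phi x y z
  /-- (φ1) -/
  phi_eq_zero : ∀ x y z, x = z ∨ y = z → phi x y z = 0
  /-- (φ2) -/
  phi_symm : ∀ x y z, phi x y z = phi y x z
  /-- (φ3) -/
  phi_small : ∀ ε : ℝ, 0 < ε → ∃ δ : ℝ, 0 < δ ∧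
    ∀ x y z, (d x z < δ ∨ d y z < δ) → phi x y z < ε

namespace PhiMetric

variable {X : Type*}

/-- The open ball `B_φ(x, r)`. -/
def ball (M : PhiMetric X) (x : X) (r : ℝ) : Set X := {y | M.d x y < r}

/-- The topology `τ_φ` generated by a φ-metric:
`G` is open iff every point of `G` has an open ball around it inside `G`. -/
def toTopology (M : PhiMetric X) : TopologicalSpace X where
  IsOpen G := ∀ x ∈ G, ∃ r > 0, M.ball x r ⊆ G
  isOpen_univ := fun x _ => ⟨1, one_pos, fun y _ => Set.mem_univ y⟩
  isOpen_inter := by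
    intro s t hs ht x hx
    obtain ⟨r1, hr1, h1⟩ := hs x hx.1
    obtain ⟨r2, hr2, h2⟩ := ht x hx.2
    refine ⟨min r1 r2, lt_min hr1 hr2, fun y hy => ⟨h1 ?_, h2 ?_⟩⟩
    · have hy' : M.d x y < min r1 r2 := hy
      exact lt_of_lt_of_le hy' (min_le_left _ _)
    · have hy' : M.d x y < min r1 r2 := hy
      exact lt_of_lt_of_le hy' (min_le_right _ _)
  isOpen_sUnion := by
    intro S hS x hx
    obtain ⟨s, hs, hxs⟩ := hx
    obtain ⟨r, hr, hb⟩ := hS s hs x hxs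
    exact ⟨r, hr, fun y hy => ⟨s, hs, hb hy⟩⟩

/-- A sequence is Cauchy with respect to a φ-metric. -/
def IsCauchySeq (M : PhiMetric X) (u : ℕ → X) : Prop :=
  ∀ ε : ℝ, 0 < ε → ∃ N : ℕ, ∀ m ≥ N, ∀ n ≥ N, M.d (u m) (u n) < ε

/-- A φ-metric space is complete if every Cauchy sequence converges. -/
def Complete (M : PhiMetric X) : Prop :=
  ∀ u : ℕ → X, M.IsCauchySeq u →
    ∃ a : X, Filter.Tendsto (fun n => M.d (u n) a) Filter.atTop (nhds 0)

end PhiMetric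

namespace PhiMetric

/-- A uniform form of the triangle inequality. -/
theorem exists_d_lt_of_d_lt {X : Type*} (M : PhiMetric X) {ε : ℝ} (hε : 0 < ε) :
    ∃ δ > 0, ∀ x y z, M.d x z < δ → M.d z y < δ → M.d x y < ε := by
  obtain ⟨δ, hδ, h⟩ := M.phi_small (ε / 3) (by positivity)
  refine ⟨min δ (ε / 3), lt_min hδ (by positivity), fun x y z hx hy => ?_⟩
  have h₁ := h x y z (Or.inl (hx.trans_le (min_le_left _ _)))
  have h₂ := hx.trans_le (min_le_right _ _)
  have h₃ := hy.trans_le (min_le_right _ _)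
  linarith [M.d_triangle x y z]

theorem d_self {X : Type*} (M : PhiMetric X) (x : X) : M.d x x = 0 :=
  (M.d_eq_zero_iff x x).2 rfl

theorem tendsto_iSup_d_zero_iff {X : Type*} (M : PhiMetric X) (F : ℕ → Set X) :
    Filter.Tendsto (fun i => ⨆ x ∈ F i, ⨆ y ∈ F i, ENNReal.ofReal (M.d x y))
      Filter.atTop (nhds 0) ↔
      ∀ ε > 0, ∃ N, ∀ n ≥ N, ∀ x ∈ F n, ∀ y ∈ F n, M.d x y < ε := by
  rw [ENNReal.tendsto_atTop_zero]
  constructor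
  · intro h ε hε
    obtain ⟨N, hN⟩ := h (ENNReal.ofReal (ε / 2)) (by simpa using hε)
    refine ⟨N, fun n hn x hx y hy => ?_⟩
    have h₁ := hN n hn
    simp only [iSup_le_iff] at h₁
    have h₂ := (ENNReal.ofReal_le_ofReal_iff (by positivity)).1 (h₁ x hx y hy)
    linarith
  · intro h ε hε
    rcases eq_or_ne ε ⊤ with rfl | htop
    · exact ⟨0, fun _ _ => le_top⟩
    obtain ⟨N, hN⟩ := h ε.toReal (ENNReal.toReal_pos hε.ne' htop)
    refine ⟨N, fun n hn => ?_⟩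
    simp only [iSup_le_iff]
    exact fun x hx y hy => ENNReal.ofReal_le_of_le_toReal (hN n hn x hx y hy).le

theorem mem_of_isClosed {X : Type*} (M : PhiMetric X) {s : Set X}
    (hs : IsClosed[M.toTopology] s) {a : X} (ha : ∀ ε > 0, ∃ y ∈ s, M.d a y < ε) :
    a ∈ s := by
  by_contra hmem
  obtain ⟨r, hr, hball⟩ := hs.isOpen_compl a hmem
  obtain ⟨y, hy, hay⟩ := ha r hr
  exact hball hay hy

/-- The points at distance zero from a set form a closed set. -/
theorem isClosed_setOf_adherent {X : Type*} (M : PhiMetric X) (s : Set X) :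
    IsClosed[M.toTopology] {x | ∀ ε > 0, ∃ y ∈ s, M.d x y < ε} := by
  refine @IsClosed.mk X M.toTopology _ fun x hx => ?_
  simp only [Set.mem_compl_iff, Set.mem_ofPred_eq, not_forall] at hx
  obtain ⟨ε, hε, hx⟩ := hx
  obtain ⟨δ, hδ, h⟩ := M.exists_d_lt_of_d_lt hε
  refine ⟨δ, hδ, fun y hxy hy => hx ?_⟩
  obtain ⟨z, hz, hyz⟩ := hy δ hδ
  exact ⟨z, hz, h x z y hxy hyz⟩

end PhiMetric

/-- Cantor-type intersection theorem: a φ-metric space is complete iff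
every nested sequence of nonempty closed sets with diameters tending to `0` has
exactly one common point. -/
theorem phiMetric_cantor {X : Type*} [Nonempty X] (M : PhiMetric X) :
    M.Complete ↔
      ∀ F : ℕ → Set X,
        (∀ i, (F i).Nonempty) →
        (∀ i, IsClosed[M.toTopology] (F i)) →
        (∀ i, F (i + 1) ⊆ F i) →
        Filter.Tendsto (fun i => ⨆ x ∈ F i, ⨆ y ∈ F i, ENNReal.ofReal (M.d x y))
          Filter.atTop (nhds 0) →
        ∃! a : X, a ∈ ⋂ i, F i := by
  constructor
  · intro hM F hne hcl hsub hdiam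
    rw [M.tendsto_iSup_d_zero_iff] at hdiam
    have hanti : Antitone F := antitone_nat_of_succ_le hsub
    choose u hu using hne
    obtain ⟨a, ha⟩ := hM u fun ε hε => by
      obtain ⟨N, hN⟩ := hdiam ε hε
      exact ⟨N, fun m hm n hn => hN N le_rfl _ (hanti hm (hu m)) _ (hanti hn (hu n))⟩
    have haF : ∀ i, a ∈ F i := fun i => M.mem_of_isClosed (hcl i) fun ε hε => by
      obtain ⟨n, hn, hin⟩ :=
        ((ha.eventually_lt_const hε).and (Filter.eventually_ge_atTop i)).exists
      exact ⟨u n, hanti hin (hu n), by rwa [M.d_symm]⟩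
    refine ⟨a, Set.mem_iInter.2 haF, fun b hb => ?_⟩
    refine (M.d_eq_zero_iff b a).1 (le_antisymm (le_of_forall_pos_lt_add fun ε hε => ?_)
      (M.d_nonneg b a))
    obtain ⟨N, hN⟩ := hdiam ε hε
    simpa using hN N le_rfl b (Set.mem_iInter.1 hb N) a (haF N)
  · intro h u hu
    let F : ℕ → Set X := fun i => {x | ∀ ε > 0, ∃ y ∈ Set.image u (Set.Ici i), M.d x y < ε}
    have huF : ∀ i n, i ≤ n → u n ∈ F i := fun i n hin ε hε =>
      ⟨u n, ⟨n, hin, rfl⟩, by rwa [M.d_self]⟩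
    have hdiam : ∀ ε > 0, ∃ N, ∀ n ≥ N, ∀ x ∈ F n, ∀ y ∈ F n, M.d x y < ε := by
      intro ε hε
      obtain ⟨δ, hδ, h₁⟩ := M.exists_d_lt_of_d_lt hε
      obtain ⟨η, hη, h₂⟩ := M.exists_d_lt_of_d_lt hδ
      obtain ⟨N, hN⟩ := hu η hη
      refine ⟨N, fun n hn x hx y hy => ?_⟩
      obtain ⟨_, ⟨k, hk, rfl⟩, hxk⟩ := hx δ hδ
      obtain ⟨_, ⟨l, hl, rfl⟩, hyl⟩ := hy η hη
      rw [M.d_symm] at hyl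
      exact h₁ x y (u k) hxk
        (h₂ (u k) y (u l) (hN k (hn.trans hk) l (hn.trans hl)) hyl)
    obtain ⟨a, ha, -⟩ := h F (fun i => ⟨u i, huF i i le_rfl⟩)
      (fun i => M.isClosed_setOf_adherent _)
      (fun i x hx ε hε => by
        obtain ⟨_, ⟨k, hk, rfl⟩, hxk⟩ := hx ε hε
        exact ⟨u k, ⟨k, (Nat.le_succ i).trans hk, rfl⟩, hxk⟩)
      ((M.tendsto_iSup_d_zero_iff F).2 hdiam)
    rw [Set.mem_iInter] at ha
    refine ⟨a, Metric.tendsto_atTop.2 fun ε hε => ?_⟩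
    obtain ⟨N, hN⟩ := hdiam ε hε
    refine ⟨N, fun n hn => ?_⟩
    rw [Real.dist_0_eq_abs, abs_of_nonneg (M.d_nonneg _ _)]
    exact hN N le_rfl _ (huF N n hn) a (ha N)
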